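/- Let (R, 𝔪) be an excellent Noetherian local domain of prime characteristic p > 0 with residue field k = R/𝔪. If Tor_1^R(R^+, k) = 0, then R is Cohen–Macaulay and normal (i.e. integrally closed in its field of fractions). -/

import Mathlib

set_option synthInstance.maxHeartbeats 1000000
set_option maxHeartbeats 1000000
set_option linter.unusedVariables false

open CategoryTheory

/-- `Tor_n^R(M, N)`, the `n`-th Tor group of the `R`-modules `M` and `N`. -/
noncomputable abbrev TorGrp (R : Type) [CommRing R] (n : ℕ)
    (M N : Type) [AddCommGroup M] [Module R M] [AddCommGroup N] [Module R N] : Type :=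
  ((Tor (ModuleCat R) n).obj (ModuleCat.of R M)).obj (ModuleCat.of R N)

/-- The absolute integral closure `R⁺` of a domain `R`: the integral closure of `R`
in an algebraic closure of its fraction field. -/
noncomputable abbrev AbsIntClo (R : Type) [CommRing R] [IsDomain R] : Type :=
  integralClosure R (AlgebraicClosure (FractionRing R))

/-- A regular local ring: a Noetherian local ring whose maximal ideal can be generated
by Krull-dimension many elements. -/
def IsRegularLocalRingP (A : Type) [CommRing A] : Prop :=
  IsNoetherianRing A ∧ ∃ h : IsLocalRing A, ∃ s : Finset A,
    Ideal.span (s : Set A) = @IsLocalRing.maximalIdeal A _ h ∧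
      (s.card : WithBot ℕ∞) = ringKrullDim A

/-- A regular ring: a Noetherian ring all of whose localizations at primes are
regular local rings. -/
def IsRegularRingP (A : Type) [CommRing A] : Prop :=
  IsNoetherianRing A ∧
    ∀ (p : Ideal A) (hp : p.IsPrime),
      haveI := hp
      IsRegularLocalRingP (Localization.AtPrime p)

/-- A chain of primes is saturated if each step is a covering relation. -/
def IsSaturatedChain {α : Type} [Preorder α] (c : LTSeries α) : Prop :=
  ∀ i : Fin c.length, c.toFun i.castSucc ⋖ c.toFun i.succ

/-- A ring is catenary if any two saturated chains of primes with the same endpoints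
have the same length. -/
def IsCatenaryRing (A : Type) [CommRing A] : Prop :=
  ∀ c₁ c₂ : LTSeries (PrimeSpectrum A),
    c₁.head = c₂.head → c₁.last = c₂.last →
      IsSaturatedChain c₁ → IsSaturatedChain c₂ → c₁.length = c₂.length

/-- A ring is universally catenary if every finitely generated algebra over it
(i.e. every quotient of a polynomial ring over it) is catenary. -/
def IsUniversallyCatenary (A : Type) [CommRing A] : Prop :=
  ∀ (n : ℕ) (I : Ideal (MvPolynomial (Fin n) A)),
    IsCatenaryRing (MvPolynomial (Fin n) A ⧸ I)

/-- A `κ`-algebra `B` is geometrically regular if `L ⊗_κ B` is a regular ring for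
every finite field extension `L` of `κ`. -/
def IsGeometricallyRegularAlgebra (κ : Type) [Field κ] (B : Type) [CommRing B]
    [Algebra κ B] : Prop :=
  ∀ (L : Type) (_ : Field L) (_ : Algebra κ L) (_ : Module.Finite κ L),
    IsRegularRingP (TensorProduct κ L B)

/-- A ring `A` is a G-ring if for every prime `p` of `A`, all fibers of the completion
map `A_p → (A_p)^∧` are geometrically regular; the fiber at a prime `q` of `A_p` is
`κ(q) ⊗_{A_p} (A_p)^∧`. -/
def IsGRing (A : Type) [CommRing A] : Prop :=
  ∀ (p : Ideal A) (hp : p.IsPrime),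
    haveI := hp
    ∀ (q : Ideal (Localization.AtPrime p)) (hq : q.IsPrime),
      haveI := hq
      IsGeometricallyRegularAlgebra
        (IsLocalRing.ResidueField (Localization.AtPrime q))
        (TensorProduct (Localization.AtPrime p)
          (IsLocalRing.ResidueField (Localization.AtPrime q))
          (AdicCompletion (IsLocalRing.maximalIdeal (Localization.AtPrime p))
            (Localization.AtPrime p)))

/-- A ring `A` is J-2 if the regular locus of every finitely generated `A`-algebra
is open in its prime spectrum. -/
def IsJ2 (A : Type) [CommRing A] : Prop :=
  ∀ (n : ℕ) (I : Ideal (MvPolynomial (Fin n) A)),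
    IsOpen {p : PrimeSpectrum (MvPolynomial (Fin n) A ⧸ I) |
      IsRegularLocalRingP (Localization.AtPrime p.asIdeal)}

/-- A ring is excellent if it is Noetherian, universally catenary, a G-ring, and J-2. -/
def IsExcellentRing (A : Type) [CommRing A] : Prop :=
  IsNoetherianRing A ∧ IsUniversallyCatenary A ∧ IsGRing A ∧ IsJ2 A

/-- A list of elements of a local ring is a system of parameters if its elements lie in
the maximal ideal, its length is the Krull dimension, and the ideal it generates has
radical the maximal ideal (i.e. is primary to the maximal ideal). -/
def IsSystemOfParameters (R : Type) [CommRing R] [IsLocalRing R] (rs : List R) : Prop :=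
  (∀ x ∈ rs, x ∈ IsLocalRing.maximalIdeal R) ∧
    (rs.length : WithBot ℕ∞) = ringKrullDim R ∧
    (Ideal.ofList rs).radical = IsLocalRing.maximalIdeal R

/-- A local ring is Cohen-Macaulay if it is Noetherian and admits a regular sequence of
length equal to its Krull dimension consisting of elements of the maximal ideal. -/
def IsCohenMacaulayLocalRing (R : Type) [CommRing R] : Prop :=
  IsNoetherianRing R ∧ ∃ h : IsLocalRing R,
    ∃ rs : List R, (∀ x ∈ rs, x ∈ @IsLocalRing.maximalIdeal R _ h) ∧
      RingTheory.Sequence.IsRegular R rs ∧ (rs.length : WithBot ℕ∞) = ringKrullDim R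

/-- An `R`-algebra `S` is a big Cohen-Macaulay `R`-algebra if some system of parameters
of `R` is an `S`-regular sequence. -/
def IsBigCohenMacaulayAlgebra (R : Type) [CommRing R] [IsLocalRing R]
    (S : Type) [CommRing S] [Algebra R S] : Prop :=
  ∃ rs : List R, IsSystemOfParameters R rs ∧ RingTheory.Sequence.IsRegular S rs

lemma lTensor_subtype_injective_of_comap {R A P F : Type*} [CommRing R] [AddCommGroup A]
    [Module R A] [AddCommGroup P] [Module R P] [AddCommGroup F] [Module R F]
    (φ : P →ₗ[R] F) (K : Submodule R F) (hK : K ⊔ LinearMap.range φ = ⊤)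
    (h : Function.Injective ((K.comap φ).subtype.lTensor A)) :
    Function.Injective (K.subtype.lTensor A) := by
  let i : K.comap φ →ₗ[R] K × P :=
    (-(φ.restrict (p := K.comap φ) (q := K) fun _ hx ↦ hx)).prod (K.comap φ).subtype
  let s : K × P →ₗ[R] F := K.subtype.coprod φ
  have hs : Function.Surjective s := by
    rw [← LinearMap.range_eq_top, LinearMap.range_coprod, Submodule.range_subtype, hK]
  have hex : Function.Exact i s := by
    rintro ⟨k, x⟩
    refine ⟨fun hx ↦ ?_, ?_⟩
    · have hx' : (k : F) = -φ x := eq_neg_of_add_eq_zero_left hx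
      refine ⟨⟨x, by simpa [hx'] using K.neg_mem k.2⟩, ?_⟩
      ext <;> simp [i, hx']
    · rintro ⟨y, hy⟩
      rw [← hy]
      simp [i, s]
  rw [injective_iff_map_eq_zero]
  intro z hz
  have hz' : s.lTensor A ((LinearMap.inl R K P).lTensor A z) = 0 := by
    rw [← LinearMap.comp_apply, ← LinearMap.lTensor_comp]
    simpa [s] using hz
  obtain ⟨w, hw⟩ := (lTensor_exact A hex hs _).1 hz'
  have hw0 : w = 0 := by
    apply h
    have := congrArg ((LinearMap.snd R K P).lTensor A) hw
    simpa [← LinearMap.comp_apply, ← LinearMap.lTensor_comp, i] using this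
  have := congrArg ((LinearMap.fst R K P).lTensor A) hw
  rw [hw0] at this
  simpa [← LinearMap.comp_apply, ← LinearMap.lTensor_comp] using this.symm

lemma lTensor_range_subtype_injective {R A P₀ P₁ P₂ : Type*} [CommRing R] [AddCommGroup A]
    [Module R A] [AddCommGroup P₀] [Module R P₀] [AddCommGroup P₁] [Module R P₁]
    [AddCommGroup P₂] [Module R P₂] (f : P₂ →ₗ[R] P₁) (g : P₁ →ₗ[R] P₀) (hgf : g ∘ₗ f = 0)
    (hex : Function.Exact (f.lTensor A) (g.lTensor A)) :
    Function.Injective ((LinearMap.range g).subtype.lTensor A) := by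
  rw [injective_iff_map_eq_zero]
  intro z hz
  obtain ⟨w, rfl⟩ := LinearMap.lTensor_surjective A g.surjective_rangeRestrict z
  rw [← LinearMap.comp_apply, ← LinearMap.lTensor_comp, LinearMap.subtype_comp_codRestrict] at hz
  obtain ⟨v, rfl⟩ := (hex _).1 hz
  have : g.rangeRestrict ∘ₗ f = 0 := by
    ext x
    exact LinearMap.congr_fun hgf x
  rw [← LinearMap.comp_apply, ← LinearMap.lTensor_comp, this]
  simp

lemma lTensor_ker_subtype_injective_of_subsingleton_tor {R : Type} [CommRing R] {A M F : Type}
    [AddCommGroup A] [Module R A] [AddCommGroup M] [Module R M] [AddCommGroup F] [Module R F]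
    (q : F →ₗ[R] M) (hq : Function.Surjective q)
    (h : Subsingleton (((Tor (ModuleCat R) 1).obj (ModuleCat.of R A)).obj (ModuleCat.of R M))) :
    Function.Injective ((LinearMap.ker q).subtype.lTensor A) := by
  let P := projectiveResolution (ModuleCat.of R M)
  let T := (MonoidalCategory.tensoringLeft (ModuleCat R)).obj (ModuleCat.of R A)
  have hT : ((T.mapHomologicalComplex _).obj P.complex).ExactAt 1 := by
    rw [HomologicalComplex.exactAt_iff_isZero_homology]
    exact (ModuleCat.isZero_of_subsingleton
      (((Tor (ModuleCat R) 1).obj (ModuleCat.of R A)).obj (ModuleCat.of R M))).of_iso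
      (P.isoLeftDerivedObj T 1).symm
  rw [HomologicalComplex.exactAt_iff' _ 2 1 0 (by simp) (by simp)] at hT
  have hex : Function.Exact ((P.complex.d 2 1).hom.lTensor A) ((P.complex.d 1 0).hom.lTensor A) :=
    (ShortComplex.ShortExact.moduleCat_exact_iff_function_exact _).1 hT
  have hinj := lTensor_range_subtype_injective (A := A) (P.complex.d 2 1).hom (P.complex.d 1 0).hom
    (by rw [← ModuleCat.hom_comp, P.complex.d_comp_d]; rfl) hex
  have hπ : Function.Exact (P.complex.d 1 0).hom (P.π.f 0).hom :=
    (ShortComplex.ShortExact.moduleCat_exact_iff_function_exact _).1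
      (ShortComplex.exact_of_g_is_cokernel (.mk _ _ P.complex_d_comp_π_f_zero)
        P.isColimitCokernelCofork)
  have hπs : Function.Surjective (P.π.f 0).hom := (ModuleCat.epi_iff_surjective _).1 inferInstance
  have : Module.Projective R (P.complex.X 0) := (IsProjective.iff_projective _).2 (P.projective 0)
  obtain ⟨φ, hφ⟩ := Module.projective_lifting_property q (P.π.f 0).hom hq
  have hr : LinearMap.range (P.complex.d 1 0).hom = (LinearMap.ker q).comap φ := by
    rw [← LinearMap.exact_iff.1 hπ, ← hφ]
    rfl
  rw [hr] at hinj
  refine lTensor_subtype_injective_of_comap φ _ ?_ hinj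
  rw [eq_top_iff]
  intro x _
  obtain ⟨y, hy⟩ := hπs (q x)
  rw [← hφ] at hy
  rw [← sub_add_cancel x (φ y)]
  refine Submodule.add_mem_sup ?_ ⟨y, rfl⟩
  rw [LinearMap.mem_ker, map_sub, sub_eq_zero]
  exact hy.symm

open IsLocalRing

section

variable {R A : Type*} [CommRing R] [IsLocalRing R]

lemma exists_notMem_forall_mul_mem_of_pow_le {I : Ideal R} (hI : I ≠ ⊤) {n : ℕ}
    (hn : maximalIdeal R ^ n ≤ I) :
    ∃ x ∉ I, ∀ c ∈ maximalIdeal R, c * x ∈ I := by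
  induction n with
  | zero => exact absurd (top_le_iff.1 (by simpa using hn)) hI
  | succ n ih =>
    by_cases h : maximalIdeal R ^ n ≤ I
    · exact ih h
    · obtain ⟨x, hx, hxI⟩ := SetLike.not_le_iff_exists.1 h
      exact ⟨x, hxI, fun c hc ↦ hn (by rw [pow_succ']; exact Ideal.mul_mem_mul hc hx)⟩

variable [IsNoetherianRing R]

lemma lTensor_ideal_subtype_injective_of_pow_le [AddCommGroup A] [Module R A]
    (h : Function.Injective ((maximalIdeal R).subtype.lTensor A)) (I : Ideal R) {n : ℕ}
    (hn : maximalIdeal R ^ n ≤ I) : Function.Injective (I.subtype.lTensor A) := by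
  induction I using IsNoetherian.induction with
  | hgt I ih =>
  by_cases hI : I = ⊤
  · subst hI
    exact (LinearEquiv.lTensor A (Submodule.topEquiv (R := R) (M := R))).injective
  obtain ⟨x, hxI, hx⟩ := exists_notMem_forall_mul_mem_of_pow_le hI hn
  let J := I ⊔ Ideal.span {x}
  have hIJ : I ≤ J := le_sup_left
  have hxJ : x ∈ J := Ideal.mem_sup_right (Ideal.mem_span_singleton_self x)
  have hlt : I < J := lt_of_le_of_ne hIJ fun e ↦ hxI (e ▸ hxJ)
  let φ : R →ₗ[R] J := LinearMap.toSpanSingleton R J ⟨x, hxJ⟩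
  let K : Submodule R J := I.submoduleOf J
  have hcomap : K.comap φ = maximalIdeal R := by
    symm
    refine (maximalIdeal.isMaximal R).eq_of_le (fun e ↦ hxI ?_) fun c hc ↦ ?_
    · have : (1 : R) ∈ K.comap φ := (Ideal.eq_top_iff_one _).1 e
      simpa [K, φ, Submodule.submoduleOf] using this
    · simpa [K, φ, Submodule.submoduleOf] using hx c hc
  have hsup : K ⊔ LinearMap.range φ = ⊤ := by
    rw [eq_top_iff]
    rintro ⟨y, hy⟩ -
    obtain ⟨a, ha, b, hb, rfl⟩ := Submodule.mem_sup.1 hy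
    obtain ⟨c, rfl⟩ := Ideal.mem_span_singleton'.1 hb
    exact Submodule.mem_sup.2 ⟨⟨a, hIJ ha⟩, ha, φ c, ⟨c, rfl⟩, rfl⟩
  have h1 := lTensor_subtype_injective_of_comap (A := A) φ K hsup (by rw [hcomap]; exact h)
  have h2 := ih J hlt (hn.trans hIJ)
  have h3 : I.subtype = J.subtype ∘ₗ K.subtype ∘ₗ (Submodule.submoduleOfEquivOfLe hIJ).symm := rfl
  rw [h3, LinearMap.lTensor_comp, LinearMap.lTensor_comp]
  exact h2.comp (h1.comp
    (LinearEquiv.lTensor A (Submodule.submoduleOfEquivOfLe hIJ).symm).injective)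

variable [CommRing A] [Algebra R A]

lemma vanishesTrivially_of_pow_le_span
    (h : Function.Injective ((maximalIdeal R).subtype.lTensor A)) {ι : Type*} [Fintype ι]
    (f : ι → R) (α : ι → A) {n : ℕ} (hn : maximalIdeal R ^ n ≤ Ideal.span (Set.range f))
    (hα : ∑ i, f i • α i = 0) : TensorProduct.VanishesTrivially R f α := by
  apply TensorProduct.vanishesTrivially_of_sum_tmul_eq_zero_of_rTensor_injective
  · rw [← LinearMap.lTensor_inj_iff_rTensor_inj]
    exact lTensor_ideal_subtype_injective_of_pow_le h _ hn
  · apply (TensorProduct.lid R A).injective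
    simpa using hα

lemma mem_of_algebraMap_mem_map_of_pow_le
    (h : Function.Injective ((maximalIdeal R).subtype.lTensor A))
    (hA : (maximalIdeal R).map (algebraMap R A) ≠ ⊤) (I : Ideal R) {n : ℕ}
    (hn : maximalIdeal R ^ n ≤ I) {r : R} (hr : algebraMap R A r ∈ I.map (algebraMap R A)) :
    r ∈ I := by
  induction I using IsNoetherian.induction with
  | hgt I ih =>
  by_cases hI : I = ⊤
  · simp [hI]
  obtain ⟨x, hxI, hx⟩ := exists_notMem_forall_mul_mem_of_pow_le hI hn
  let J := I ⊔ Ideal.span {x}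
  have hIJ : I ≤ J := le_sup_left
  have hxJ : x ∈ J := Ideal.mem_sup_right (Ideal.mem_span_singleton_self x)
  have hrJ : r ∈ J := ih J (lt_of_le_of_ne hIJ fun e ↦ hxI (e ▸ hxJ)) (hn.trans hIJ)
    (Ideal.map_mono hIJ hr)
  obtain ⟨a, ha, b, hb, rfl⟩ := Submodule.mem_sup.1 hrJ
  obtain ⟨c, rfl⟩ := Ideal.mem_span_singleton'.1 hb
  by_cases hc : c ∈ maximalIdeal R
  · exact I.add_mem ha (hx c hc)
  exfalso
  have hc : IsUnit c := by simpa using hc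
  have hxA : algebraMap R A x ∈ Ideal.map (algebraMap R A) I := by
    rw [map_add, Ideal.add_mem_iff_right _ (Ideal.mem_map_of_mem (algebraMap R A) ha),
      map_mul] at hr
    exact (Ideal.unit_mul_mem_iff_mem _ (hc.map _)).1 hr
  obtain ⟨m, f, hf⟩ := Submodule.fg_iff_exists_fin_generating_family.1 (IsNoetherian.noetherian I)
  have hf : Ideal.span (Set.range f) = I := hf
  rw [← hf, Ideal.map_span, ← Set.range_comp, Ideal.mem_span_range_iff_exists_fun] at hxA
  obtain ⟨β, hβ⟩ := hxA
  have hle : I ≤ Ideal.span (Set.range (Fin.cons x f : Fin (m + 1) → R)) := by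
    rw [Fin.range_cons, ← hf]
    exact Ideal.span_mono (Set.subset_insert _ _)
  have hsum : ∑ i, (Fin.cons x f : Fin (m + 1) → R) i •
      (Fin.cons (-1) β : Fin (m + 1) → A) i = 0 := by
    rw [Fin.sum_univ_succ]
    simp only [Fin.cons_zero, Fin.cons_succ, Algebra.smul_def]
    rw [← hβ]
    simp [mul_comm]
  obtain ⟨k, u, y, h1, h2⟩ := vanishesTrivially_of_pow_le_span h _ _ (hn.trans hle) hsum
  have hu (j) : u 0 j ∈ maximalIdeal R := by
    by_contra hj
    have hj : IsUnit (u 0 j) := by simpa using hj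
    apply hxI
    rw [← Ideal.unit_mul_mem_iff_mem _ hj]
    have := h2 j
    rw [Fin.sum_univ_succ] at this
    simp only [Fin.cons_zero, Fin.cons_succ, smul_eq_mul] at this
    rw [eq_neg_of_add_eq_zero_left this]
    exact I.neg_mem (I.sum_mem fun i _ ↦ Ideal.mul_mem_left _ _ (hf ▸ Ideal.subset_span ⟨i, rfl⟩))
  apply hA
  rw [Ideal.eq_top_iff_one, ← neg_mem_iff]
  have := h1 0
  simp only [Fin.cons_zero] at this
  rw [this]
  refine Ideal.sum_mem _ fun j _ ↦ ?_
  rw [Algebra.smul_def]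
  exact Ideal.mul_mem_right _ _ (Ideal.mem_map_of_mem _ (hu j))

lemma exists_minimal_generators_maximalIdeal (R : Type*) [CommRing R] [IsLocalRing R]
    [IsNoetherianRing R] : ∃ (n : ℕ) (x : Fin n → R),
      Ideal.span (Set.range x) = maximalIdeal R ∧
        ∀ s : Fin n → R, ∑ i, s i * x i = 0 → ∀ i, s i ∈ maximalIdeal R := by
  classical
  have hex : ∃ n, ∃ x : Fin n → R, Ideal.span (Set.range x) = maximalIdeal R :=
    Submodule.fg_iff_exists_fin_generating_family.1 (IsNoetherian.noetherian (maximalIdeal R))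
  obtain ⟨x, hx⟩ := Nat.find_spec hex
  refine ⟨Nat.find hex, x, hx, fun s hs i ↦ ?_⟩
  by_contra hi
  have hi : IsUnit (s i) := by simpa using hi
  obtain ⟨n, hn⟩ : ∃ n, Nat.find hex = n + 1 := Nat.exists_eq_succ_of_ne_zero fun e ↦ by
    rw [e] at i; exact i.elim0
  refine Nat.find_min hex (m := n) (by omega) ?_
  generalize Nat.find hex = k at *
  subst hn
  refine ⟨x ∘ i.succAbove, le_antisymm ?_ ?_⟩
  · rw [← hx]
    exact Ideal.span_mono (Set.range_comp_subset_range _ _)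
  · rw [← hx, Ideal.span_le]
    have hmem (j) : x (i.succAbove j) ∈ Ideal.span (Set.range (x ∘ i.succAbove)) :=
      Ideal.subset_span ⟨j, rfl⟩
    rintro _ ⟨l, rfl⟩
    induction l using Fin.succAboveCases i with
    | x =>
      rw [Fin.sum_univ_succAbove _ i] at hs
      rw [SetLike.mem_coe, ← Ideal.unit_mul_mem_iff_mem _ hi, eq_neg_of_add_eq_zero_left hs]
      exact neg_mem (Ideal.sum_mem _ fun j _ ↦ Ideal.mul_mem_left _ _ (hmem j))
    | p j => exact hmem j
end

/-- A finite family `f` is independent in the sense of Lech if the coefficients of every linear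
relation among its members lie in the ideal that it generates. -/
def LechIndependent {R ι : Type*} [CommRing R] [Fintype ι] (f : ι → R) : Prop :=
  ∀ a : ι → R, ∑ i, a i * f i = 0 → ∀ i, a i ∈ Ideal.span (Set.range f)

lemma LechIndependent.of_update_mul {R ι : Type*} [CommRing R] [Fintype ι] [DecidableEq ι]
    {f : ι → R} {i : ι} {g h : R} (H : LechIndependent (Function.update f i (g * h))) :
    LechIndependent (Function.update f i g) := by
  have hle : Ideal.span (Set.range (Function.update f i (g * h))) ≤
      Ideal.span (Set.range (Function.update f i g)) := by
    rw [Ideal.span_le]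
    rintro _ ⟨j, rfl⟩
    obtain rfl | hj := eq_or_ne j i
    · rw [Function.update_self]
      exact Ideal.mul_mem_right _ _ (Ideal.subset_span ⟨j, by simp⟩)
    · exact Ideal.subset_span ⟨j, by simp [hj]⟩
  have key (G : R) (a : ι → R) : ∑ j, a j * Function.update f i G j =
      a i * G + ∑ j ∈ Finset.univ.erase i, a j * f j := by
    rw [← Finset.add_sum_erase _ _ (Finset.mem_univ i), Function.update_self]
    congr 1
    exact Finset.sum_congr rfl fun j hj ↦ by rw [Function.update_of_ne (Finset.ne_of_mem_erase hj)]
  intro a ha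
  have h1 : a i ∈ Ideal.span (Set.range (Function.update f i (g * h))) := by
    have := H (Function.update (h • a) i (a i)) ?_ i
    · simpa using this
    · rw [key] at ha ⊢
      rw [Function.update_self]
      have : ∑ j ∈ Finset.univ.erase i, Function.update (h • a) i (a i) j * f j =
          h * ∑ j ∈ Finset.univ.erase i, a j * f j := by
        rw [Finset.mul_sum]
        refine Finset.sum_congr rfl fun j hj ↦ ?_
        rw [Function.update_of_ne (Finset.ne_of_mem_erase hj), Pi.smul_apply, smul_eq_mul, mul_assoc]
      rw [this]
      linear_combination h * ha
  intro j
  obtain rfl | hj := eq_or_ne j i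
  · exact hle h1
  obtain ⟨s, hs⟩ := Ideal.mem_span_range_iff_exists_fun.1 h1
  have h2 := H (Function.update (a + g • s) i (s i * g)) ?_ j
  · rw [Function.update_of_ne hj] at h2
    refine (Ideal.add_mem_iff_left _ ?_).1 (hle h2)
    exact Ideal.mul_mem_right _ _ (Ideal.subset_span ⟨i, by simp⟩)
  · rw [key] at ha hs ⊢
    rw [Function.update_self]
    have : ∑ j ∈ Finset.univ.erase i, Function.update (a + g • s) i (s i * g) j * f j =
        ∑ j ∈ Finset.univ.erase i, a j * f j + g * ∑ j ∈ Finset.univ.erase i, s j * f j := by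
      rw [Finset.mul_sum, ← Finset.sum_add_distrib]
      refine Finset.sum_congr rfl fun j hj ↦ ?_
      rw [Function.update_of_ne (Finset.ne_of_mem_erase hj), Pi.add_apply, Pi.smul_apply,
        smul_eq_mul]
      ring
    rw [this]
    linear_combination ha + g * hs

lemma LechIndependent.of_dvd {R ι : Type*} [CommRing R] [Fintype ι] {f g : ι → R}
    (H : LechIndependent f) (hgf : ∀ i, g i ∣ f i) : LechIndependent g := by
  classical
  suffices ∀ s : Finset ι, LechIndependent (s.piecewise g f) by simpa using this Finset.univ
  intro s
  induction s using Finset.induction_on with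
  | empty => simpa
  | insert i s hi ih =>
    rw [Finset.piecewise_insert]
    obtain ⟨h, hh⟩ := hgf i
    apply LechIndependent.of_update_mul (h := h)
    rwa [← hh, ← Finset.piecewise_eq_of_notMem s g f hi, Function.update_eq_self]

lemma mem_of_forall_mem_sup_pow {R : Type*} [CommRing R] [IsLocalRing R] [IsNoetherianRing R]
    {I : Ideal R} {r : R} (h : ∀ n, r ∈ I ⊔ maximalIdeal R ^ n) : r ∈ I := by
  rw [← Ideal.Quotient.eq_zero_iff_mem, ← Submodule.mem_bot R,
    ← (maximalIdeal R).iInf_pow_smul_eq_bot_of_isLocalRing (M := R ⧸ I)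
      (maximalIdeal.isMaximal R).ne_top, Submodule.mem_iInf]
  intro n
  obtain ⟨a, ha, b, hb, rfl⟩ := Submodule.mem_sup.1 (h n)
  rw [map_add, Ideal.Quotient.eq_zero_iff_mem.2 ha, zero_add]
  have : Ideal.Quotient.mk I b = b • (1 : R ⧸ I) := by
    rw [Algebra.smul_def, mul_one]
    rfl
  rw [this]
  exact Submodule.smul_mem_smul hb trivial

lemma LechIndependent.pow_of_lTensor_injective {R A : Type*} [CommRing R] [IsLocalRing R]
    [IsNoetherianRing R] [CommRing A] [IsReduced A] [Algebra R A] {p : ℕ} [Fact p.Prime]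
    [CharP R p] [CharP A p]
    (h : Function.Injective ((maximalIdeal R).subtype.lTensor A))
    (hA : (maximalIdeal R).map (algebraMap R A) ≠ ⊤) {e : ℕ}
    (hroot : ∀ a : A, ∃ b, b ^ p ^ e = a) {n : ℕ} {x : Fin n → R}
    (hx : Ideal.span (Set.range x) = maximalIdeal R)
    (hmin : ∀ s : Fin n → R, ∑ i, s i * x i = 0 → ∀ i, s i ∈ maximalIdeal R) :
    LechIndependent fun i ↦ x i ^ p ^ e := by
  have hp : p ^ e ≠ 0 := pow_ne_zero _ (Fact.out : p.Prime).ne_zero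
  intro a ha i
  choose α hα using fun i ↦ hroot (algebraMap R A (a i))
  have hsum : ∑ i, x i • α i = 0 := by
    refine (pow_eq_zero_iff hp).1 ?_
    rw [sum_pow_char_pow, ← map_zero (algebraMap R A), ← ha, map_sum]
    refine Finset.sum_congr rfl fun i _ ↦ ?_
    rw [Algebra.smul_def, mul_pow, hα, map_mul, map_pow, mul_comm]
  obtain ⟨k, u, y, h1, h2⟩ := vanishesTrivially_of_pow_le_span (n := 1) h x α
    (by rw [hx, pow_one]) hsum
  have hrad : maximalIdeal R ≤ (Ideal.span (Set.range fun i ↦ x i ^ p ^ e)).radical := by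
    rw [← hx, Ideal.span_le]
    rintro _ ⟨j, rfl⟩
    exact ⟨p ^ e, Ideal.subset_span ⟨j, rfl⟩⟩
  obtain ⟨N, hN⟩ := Ideal.exists_pow_le_of_le_radical_of_fg hrad (IsNoetherian.noetherian _)
  refine mem_of_algebraMap_mem_map_of_pow_le h hA _ hN ?_
  rw [← hα, h1, sum_pow_char_pow]
  refine Ideal.sum_mem _ fun j _ ↦ ?_
  have hu : u i j ∈ Ideal.span (Set.range x) :=
    hx ▸ hmin (u · j) (by simpa using h2 j) i
  obtain ⟨c, hc⟩ := Ideal.mem_span_range_iff_exists_fun.1 hu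
  rw [Algebra.smul_def, mul_pow, ← map_pow, ← hc, sum_pow_char_pow]
  refine Ideal.mul_mem_right _ _ (Ideal.mem_map_of_mem _ (Ideal.sum_mem _ fun l _ ↦ ?_))
  rw [mul_pow]
  exact Ideal.mul_mem_left _ _ (Ideal.subset_span ⟨l, rfl⟩)

lemma mem_span_of_mul_mem_of_lechIndependent_pow {R : Type*} [CommRing R] [IsLocalRing R]
    [IsNoetherianRing R] {n : ℕ} {x : Fin n → R} (hx : Ideal.span (Set.range x) = maximalIdeal R)
    (hind : ∀ N, ∃ q ≥ N, LechIndependent fun i ↦ x i ^ q) (i : Fin n) {r : R}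
    (hr : r * x i ∈ Ideal.span (Set.range fun j ↦ if j < i then x j else 0)) :
    r ∈ Ideal.span (Set.range fun j ↦ if j < i then x j else 0) := by
  refine mem_of_forall_mem_sup_pow fun N ↦ ?_
  obtain ⟨q, hqN, hq⟩ := hind (N + 1)
  obtain ⟨c, hc⟩ := Ideal.mem_span_range_iff_exists_fun.1 hr
  have hg : LechIndependent fun j ↦ if j < i then x j else x j ^ q := by
    refine hq.of_dvd fun j ↦ ?_
    split_ifs
    · exact dvd_pow_self _ (by omega)
    · rfl
  have := hg (fun j ↦ if j < i then x i ^ (q - 1) * c j else if j = i then -r else 0) ?_ i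
  · simp only [lt_irrefl, if_false, if_true, neg_mem_iff] at this
    refine (Ideal.span_le.2 ?_ : Ideal.span _ ≤ _) this
    rintro _ ⟨j, rfl⟩
    dsimp only
    split_ifs with hj
    · exact Ideal.mem_sup_left (Ideal.subset_span ⟨j, by simp [hj]⟩)
    · refine Ideal.mem_sup_right (Ideal.pow_le_pow_right (by omega : N ≤ q) ?_)
      exact Ideal.pow_mem_pow (hx ▸ Ideal.subset_span ⟨j, rfl⟩) _
  · have key (j) : (if j < i then x i ^ (q - 1) * c j else if j = i then -r else 0) *
        (if j < i then x j else x j ^ q) =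
        x i ^ (q - 1) * (c j * if j < i then x j else 0) + if j = i then -r * x i ^ q else 0 := by
      rcases lt_trichotomy j i with hj | rfl | hj
      · simp [hj, hj.ne, mul_assoc]
      · simp
      · simp [hj.not_gt, hj.ne']
    simp only [key, Finset.sum_add_distrib, ← Finset.mul_sum, hc, Finset.sum_ite_eq',
      Finset.mem_univ, if_true]
    obtain ⟨m, rfl⟩ : ∃ m, q = m + 1 := ⟨q - 1, by omega⟩
    rw [Nat.add_sub_cancel]
    ring

lemma isWeaklyRegular_ofFn_of_lechIndependent_pow {R : Type*} [CommRing R] [IsLocalRing R]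
    [IsNoetherianRing R] {n : ℕ} {x : Fin n → R} (hx : Ideal.span (Set.range x) = maximalIdeal R)
    (hind : ∀ N, ∃ q ≥ N, LechIndependent fun i ↦ x i ^ q) :
    RingTheory.Sequence.IsWeaklyRegular R (List.ofFn x) := by
  refine ⟨fun i hi ↦ ?_⟩
  have hi' : i < n := by simpa using hi
  have hspan : Ideal.ofList ((List.ofFn x).take i) • (⊤ : Submodule R R) =
      Ideal.span (Set.range fun j ↦ if j < (⟨i, hi'⟩ : Fin n) then x j else 0) := by
    rw [smul_eq_mul, Ideal.mul_top]
    apply le_antisymm <;> refine Ideal.span_le.2 ?_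
    · intro y hy
      obtain ⟨j, hj, rfl⟩ := List.mem_take_iff_getElem.1 hy
      rw [lt_min_iff, List.length_ofFn] at hj
      exact Ideal.subset_span ⟨⟨j, hj.2⟩, by simp [hj.1]⟩
    · rintro _ ⟨j, rfl⟩
      dsimp only
      split_ifs with hj
      · exact Ideal.subset_span (List.mem_take_iff_getElem.2
          ⟨j, by simpa using Fin.lt_def.1 hj, by simp⟩)
      · exact zero_mem _
  rw [hspan, isSMulRegular_quotient_iff_mem_of_smul_mem]
  intro r hr
  refine mem_span_of_mul_mem_of_lechIndependent_pow hx hind _ ?_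
  simpa [mul_comm] using hr

/-- A Noetherian local ring whose maximal ideal is generated by a regular sequence is
Cohen-Macaulay. -/
lemma isCohenMacaulayLocalRing_of_isWeaklyRegular {R : Type} [CommRing R] [IsLocalRing R]
    [IsNoetherianRing R] {rs : List R} (hrs : Ideal.ofList rs = maximalIdeal R)
    (hreg : RingTheory.Sequence.IsWeaklyRegular R rs) : IsCohenMacaulayLocalRing R := by
  have hmem : ∀ r ∈ rs, r ∈ maximalIdeal R := fun r hr ↦ hrs ▸ Ideal.subset_span hr
  have hreg' := RingTheory.Sequence.IsRegular.of_isWeaklyRegular_of_mem_maximalIdeal R hmem hreg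
  refine ⟨inferInstance, inferInstance, rs, hmem, hreg', ?_⟩
  have := ringKrullDim_add_length_eq_ringKrullDim_of_isRegular rs hreg'
  rw [← this, hrs, ringKrullDim_eq_zero_of_isField
    ((Ideal.Quotient.maximal_ideal_iff_isField_quotient _).1 (maximalIdeal.isMaximal R)), zero_add]

lemma AbsIntClo.algebraMap_injective (R : Type) [CommRing R] [IsDomain R] :
    Function.Injective (algebraMap R (AbsIntClo R)) := by
  refine Function.Injective.of_comp (f := Subtype.val) ?_
  change Function.Injective (algebraMap R (AlgebraicClosure (FractionRing R)))
  rw [IsScalarTower.algebraMap_eq R (FractionRing R)]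
  exact (algebraMap (FractionRing R) _).injective.comp (IsFractionRing.injective R _)

lemma AbsIntClo.exists_pow_eq {R : Type} [CommRing R] [IsDomain R] (a : AbsIntClo R) {n : ℕ}
    (hn : 0 < n) : ∃ b : AbsIntClo R, b ^ n = a := by
  obtain ⟨b, hb⟩ := IsAlgClosed.exists_pow_nat_eq (a : AlgebraicClosure (FractionRing R)) hn
  exact ⟨⟨b, IsIntegral.of_pow hn (hb ▸ a.2)⟩, Subtype.ext hb⟩

lemma isIntegrallyClosed_of_mem_of_algebraMap_mem_map {R : Type} [CommRing R] [IsDomain R]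
    [IsLocalRing R] [IsNoetherianRing R]
    (h : ∀ (I : Ideal R) (n : ℕ) (r : R), maximalIdeal R ^ n ≤ I →
      algebraMap R (AbsIntClo R) r ∈ I.map (algebraMap R (AbsIntClo R)) → r ∈ I) :
    IsIntegrallyClosed R := by
  rw [isIntegrallyClosed_iff (FractionRing R)]
  intro x hx
  obtain ⟨a, b, hb, rfl⟩ := IsFractionRing.div_surjective (A := R) x
  have hb0 : algebraMap R (FractionRing R) b ≠ 0 := by simpa using nonZeroDivisors.ne_zero hb
  let ξ : AbsIntClo R := ⟨algebraMap (FractionRing R) _ (algebraMap R _ a / algebraMap R _ b),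
    hx.map (IsScalarTower.toAlgHom R (FractionRing R) (AlgebraicClosure (FractionRing R)))⟩
  have hξ : algebraMap R (AbsIntClo R) a = algebraMap R (AbsIntClo R) b * ξ := by
    apply Subtype.ext
    change algebraMap R (AlgebraicClosure (FractionRing R)) a =
      algebraMap R (AlgebraicClosure (FractionRing R)) b * algebraMap (FractionRing R) _ _
    rw [IsScalarTower.algebraMap_apply R (FractionRing R),
      IsScalarTower.algebraMap_apply R (FractionRing R) _ b, ← map_mul, mul_div_cancel₀ _ hb0]
  have hab : a ∈ Ideal.span {b} := by
    refine mem_of_forall_mem_sup_pow fun n ↦ h _ n a le_sup_right ?_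
    rw [hξ]
    exact Ideal.mul_mem_right _ _
      (Ideal.mem_map_of_mem _ (Ideal.mem_sup_left (Ideal.mem_span_singleton_self b)))
  obtain ⟨c, rfl⟩ := Ideal.mem_span_singleton'.1 hab
  exact ⟨c, by rw [map_mul, mul_div_cancel_right₀ _ hb0]⟩

/-- If `(R, 𝔪)` is an excellent local domain of prime characteristic `p` with
`Tor_1^R(R⁺, k) = 0`, then `R` is Cohen-Macaulay and normal. -/
theorem cohenMacaulay_and_normal_of_tor_one_vanishing
    (R : Type) [CommRing R] [IsDomain R] [IsNoetherianRing R] [IsLocalRing R]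
    (hExc : IsExcellentRing R)
    (p : ℕ) (hp : p.Prime) [CharP R p]
    (htor : Subsingleton (TorGrp R 1 (AbsIntClo R) (IsLocalRing.ResidueField R))) :
    IsCohenMacaulayLocalRing R ∧ IsIntegrallyClosed R := by
  have : Fact p.Prime := ⟨hp⟩
  have : CharP (AbsIntClo R) p :=
    charP_of_injective_algebraMap (AbsIntClo.algebraMap_injective R) p
  have hinj : Function.Injective ((maximalIdeal R).subtype.lTensor (AbsIntClo R)) := by
    have := lTensor_ker_subtype_injective_of_subsingleton_tor
      (Algebra.linearMap R (ResidueField R)) residue_surjective htor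
    rwa [show LinearMap.ker (Algebra.linearMap R (ResidueField R)) = maximalIdeal R from
      ker_residue] at this
  have hA : (maximalIdeal R).map (algebraMap R (AbsIntClo R)) ≠ ⊤ := by
    rw [Ne, Ideal.map_eq_top_iff _ (AbsIntClo.algebraMap_injective R)
      Algebra.IsIntegral.isIntegral]
    exact (maximalIdeal.isMaximal R).ne_top
  refine ⟨?_, isIntegrallyClosed_of_mem_of_algebraMap_mem_map fun I n r hn hr ↦
    mem_of_algebraMap_mem_map_of_pow_le hinj hA I hn hr⟩
  obtain ⟨n, x, hx, hmin⟩ := exists_minimal_generators_maximalIdeal R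
  refine isCohenMacaulayLocalRing_of_isWeaklyRegular (rs := List.ofFn x) ?_
    (isWeaklyRegular_ofFn_of_lechIndependent_pow hx fun N ↦ ⟨p ^ N, (Nat.lt_pow_self hp.one_lt).le,
      .pow_of_lTensor_injective hinj hA
        (fun a ↦ AbsIntClo.exists_pow_eq a (pow_pos hp.pos N)) hx hmin⟩)
  rw [← hx]
  simp [Ideal.ofList, Set.range, List.mem_ofFn]
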